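/- Let n be a nonempty finite type with decidable equality, N := Fintype.card n, and let H : Matrix n n ℂ be a Hermitian matrix. Then finrank ℂ {A : Matrix n n ℂ | A * H = H * A} = N if and only if the eigenvalue function hH.eigenvalues : n → ℝ is injective (i.e., all eigenvalues of H are distinct). (Attainment condition for the lower bound in inequality (7) of the paper.) -/

import Mathlib

open Matrix

/-- An algebra equivalence preserves the dimension of centralizers. -/
theorem AlgEquiv.finrank_centralizer_singleton {R A B : Type*} [CommRing R] [Ring A] [Ring B]
    [Algebra R A] [Algebra R B] (e : A ≃ₐ[R] B) (a : A) :
    Module.finrank R (Subalgebra.centralizer R ({e a} : Set B)) =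
      Module.finrank R (Subalgebra.centralizer R ({a} : Set A)) := by
  refine (LinearEquiv.ofSubmodules e.symm.toLinearEquiv
    (Subalgebra.toSubmodule (Subalgebra.centralizer R ({e a} : Set B)))
    (Subalgebra.toSubmodule (Subalgebra.centralizer R ({a} : Set A))) ?_).finrank_eq
  ext x
  refine (Submodule.mem_map_equiv (e := e.symm.toLinearEquiv) _).trans ?_
  simp [Subalgebra.mem_centralizer_iff, ← map_mul]

theorem Matrix.mem_centralizer_diagonal_iff {n K : Type*} [Fintype n] [DecidableEq n] [Field K]
    (d : n → K) (A : Matrix n n K) :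
    A ∈ Subalgebra.centralizer K ({diagonal d} : Set (Matrix n n K)) ↔
      ∀ i j, d i ≠ d j → A i j = 0 := by
  simp only [Subalgebra.mem_centralizer_iff, Set.mem_singleton_iff, forall_eq]
  simp only [← Matrix.ext_iff, diagonal_mul, mul_diagonal]
  refine forall₂_congr fun i j => ?_
  rw [mul_comm (A i j), mul_eq_mul_right_iff]
  tauto

/-- The centralizer of a diagonal matrix consists of the matrices supported on the pairs of indices
with equal diagonal entries. -/
def Matrix.centralizerDiagonalEquiv {n K : Type*} [Fintype n] [DecidableEq n] [Field K]
    [DecidableEq K] (d : n → K) :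
    Subalgebra.centralizer K ({diagonal d} : Set (Matrix n n K)) ≃ₗ[K]
      ({p : n × n // d p.1 = d p.2} → K) where
  toFun A p := A.1 p.1.1 p.1.2
  map_add' _ _ := rfl
  map_smul' _ _ := rfl
  invFun f := ⟨of fun i j => if h : d i = d j then f ⟨(i, j), h⟩ else 0,
    (mem_centralizer_diagonal_iff d _).2 fun i j h => by simp [h]⟩
  left_inv A := by
    ext i j
    by_cases h : d i = d j
    · simp [h]
    · simp [h, (mem_centralizer_diagonal_iff d A.1).1 A.2 i j h]
  right_inv f := by
    ext ⟨⟨i, j⟩, h⟩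
    simp_all

theorem Function.card_pairs_eq_card_iff_injective {n α : Type*} [Fintype n] [DecidableEq α]
    (d : n → α) :
    Fintype.card {p : n × n // d p.1 = d p.2} = Fintype.card n ↔ Function.Injective d := by
  let δ : n → {p : n × n // d p.1 = d p.2} := fun i => ⟨(i, i), rfl⟩
  have hδ : Function.Injective δ := fun i j h => congrArg (fun p => p.1.1) h
  constructor
  · intro h i j hij
    obtain ⟨k, hk⟩ := ((Fintype.bijective_iff_injective_and_card δ).2 ⟨hδ, h.symm⟩).2 ⟨(i, j), hij⟩
    exact (congrArg (fun p => p.1.1) hk).symm.trans (congrArg (fun p => p.1.2) hk)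
  · intro h
    refine (Fintype.card_of_bijective (f := δ) ⟨hδ, ?_⟩).symm
    rintro ⟨⟨i, j⟩, hij⟩
    exact ⟨i, Subtype.ext (Prod.ext rfl (h hij))⟩

theorem finrank_commutant_eq_card_iff_simple_spectrum
    {n : Type*} [Fintype n] [Nonempty n] [DecidableEq n]
    (H : Matrix n n ℂ) (hH : H.IsHermitian) :
    Module.finrank ℂ (Subalgebra.centralizer ℂ ({H} : Set (Matrix n n ℂ))) =
        Fintype.card n ↔
      Function.Injective hH.eigenvalues := by
  have h := AlgEquiv.finrank_centralizer_singleton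
    (Unitary.conjStarAlgAut ℂ _ hH.eigenvectorUnitary).toAlgEquiv
    (diagonal (RCLike.ofReal ∘ hH.eigenvalues))
  rw [StarAlgEquiv.coe_toAlgEquiv, ← hH.spectral_theorem] at h
  rw [h, (centralizerDiagonalEquiv _).finrank_eq, Module.finrank_fintype_fun_eq_card,
    Function.card_pairs_eq_card_iff_injective]
  exact Function.Injective.of_comp_iff RCLike.ofReal_injective _
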